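/- If δ > 0 satisfies δ ≤ Δ(ε)/ε² for all 0 < ε < 1, then R(g,n) ≤ δ^{−1/2} √(gn) for all integers n ≥ g ≥ 1. In particular, R(g,n) ≤ (0.591389)^{−1/2} √(gn) < 1.30036 √(gn) for all n ≥ g ≥ 1. -/

import Mathlib

open MeasureTheory

/-- A set `C ⊆ ℝ` is symmetric if there is a center `c` with `c + x ∈ C ↔ c - x ∈ C`. -/
def IsSymmetricSet (C : Set ℝ) : Prop := ∃ c : ℝ, ∀ x : ℝ, c + x ∈ C ↔ c - x ∈ C

/-- `DD A` is the supremum of measures of measurable symmetric subsets of `A`. -/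
noncomputable def DD (A : Set ℝ) : ℝ :=
  sSup {m : ℝ | ∃ C : Set ℝ, C ⊆ A ∧ MeasurableSet C ∧ IsSymmetricSet C ∧ m = (volume C).toReal}

/-- `Δ ε` is the infimum of `DD A` over measurable `A ⊆ [0,1)` with measure `ε`. -/
noncomputable def Δ (ε : ℝ) : ℝ :=
  sInf {d : ℝ | ∃ A : Set ℝ, A ⊆ Set.Ico (0:ℝ) 1 ∧ MeasurableSet A ∧
    volume A = ENNReal.ofReal ε ∧ d = DD A}

/-- `S` is a B*[g] set: for every `m` there are at most `g` ordered pairs in `S × S`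
summing to `m`. -/
def IsBStar (g : ℕ) (S : Finset ℤ) : Prop :=
  ∀ m : ℤ, ((S ×ˢ S).filter (fun p => p.1 + p.2 = m)).card ≤ g

/-- `R g n` is the largest cardinality of a B*[g] set contained in `{1, …, n}`. -/
noncomputable def R (g n : ℕ) : ℕ :=
  sSup {k : ℕ | ∃ S : Finset ℤ, S ⊆ Finset.Icc 1 (n : ℤ) ∧ IsBStar g S ∧ S.card = k}

lemma exists_card_eq_R (g n : ℕ) :
    ∃ S : Finset ℤ, S ⊆ Finset.Icc 1 (n : ℤ) ∧ IsBStar g S ∧ S.card = R g n := by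
  refine Nat.sSup_mem (s := {k : ℕ | ∃ S : Finset ℤ, S ⊆ Finset.Icc 1 (n : ℤ) ∧
    IsBStar g S ∧ S.card = k}) ⟨0, ∅, by simp, fun m => by simp, by simp⟩ ⟨n, ?_⟩
  rintro k ⟨S, hSn, -, rfl⟩
  simpa using Finset.card_le_card hSn

lemma le_rpow_neg_half_mul_sqrt {δ x y : ℝ} (hδ : 0 < δ) (h : δ * x ^ 2 ≤ y) :
    x ≤ δ ^ (-(1 / 2) : ℝ) * √y := by
  rw [Real.rpow_neg hδ.le, ← Real.sqrt_eq_rpow, inv_mul_eq_div,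
    le_div_iff₀ (Real.sqrt_pos.2 hδ)]
  refine Real.le_sqrt_of_sq_le ?_
  rw [mul_pow, Real.sq_sqrt hδ.le]
  linarith

/-! ### Bounding `Δ` by the measure of symmetric subsets of unions of intervals -/

lemma DD_nonneg (A : Set ℝ) : 0 ≤ DD A := by
  refine Real.sSup_nonneg ?_
  rintro _ ⟨C, -, -, -, rfl⟩
  exact ENNReal.toReal_nonneg

lemma Delta_le_DD {A : Set ℝ} {ε : ℝ} (hA : A ⊆ Set.Ico (0 : ℝ) 1) (hm : MeasurableSet A)
    (hv : volume A = ENNReal.ofReal ε) : Δ ε ≤ DD A := by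
  refine csInf_le ⟨0, ?_⟩ ⟨A, hA, hm, hv, rfl⟩
  rintro _ ⟨B, -, -, -, rfl⟩
  exact DD_nonneg B

lemma Delta_le_self {ε : ℝ} (h0 : 0 ≤ ε) (h1 : ε ≤ 1) : Δ ε ≤ ε := by
  refine (Delta_le_DD (A := Set.Ico 0 ε) (Set.Ico_subset_Ico_right h1) measurableSet_Ico
    (by simp)).trans (Real.sSup_le ?_ h0)
  rintro _ ⟨C, hC, -, -, rfl⟩
  refine ENNReal.toReal_le_of_le_ofReal h0 ((measure_mono hC).trans ?_)
  simp

lemma le_one_of_le_Delta {δ : ℝ} (hδ : 0 < δ)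
    (h : ∀ ε : ℝ, 0 < ε → ε < 1 → δ ≤ Δ ε / ε ^ 2) : δ ≤ 1 := by
  by_contra! h1
  have hinv : δ * δ⁻¹ = 1 := mul_inv_cancel₀ hδ.ne'
  have hinv0 : 0 < δ⁻¹ := inv_pos.2 hδ
  have hinv1 : δ⁻¹ < 1 := inv_lt_one_of_one_lt₀ h1
  set ε := (1 + δ⁻¹) / 2 with hε
  have hε0 : 0 < ε := by positivity
  have hε1 : ε < 1 := by linarith
  have := (le_div_iff₀ (by positivity)).1 (h ε hε0 hε1)
  have h2 : δ * ε ^ 2 ≤ ε := this.trans (Delta_le_self hε0.le hε1.le)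
  have h3 : δ * ε ≤ 1 := by nlinarith
  rw [hε] at h3
  linarith

/-- The union of the intervals `[(s - 1) / n, s / n)` over `s ∈ S`. -/
def stepSet (n : ℕ) (S : Finset ℤ) : Set ℝ :=
  ⋃ s ∈ S, Set.Ico (((s : ℝ) - 1) / n) (s / n)

lemma measurableSet_stepSet (n : ℕ) (S : Finset ℤ) : MeasurableSet (stepSet n S) :=
  S.measurableSet_biUnion fun _ _ => measurableSet_Ico

lemma stepSet_subset {n : ℕ} {S : Finset ℤ} (hn : 1 ≤ n) (hS : S ⊆ Finset.Icc 1 (n : ℤ)) :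
    stepSet n S ⊆ Set.Ico 0 1 := by
  have hn0 : (0 : ℝ) < n := by exact_mod_cast hn
  refine Set.iUnion₂_subset fun s hs => ?_
  obtain ⟨h1, h2⟩ := Finset.mem_Icc.1 (hS hs)
  have h1' : (1 : ℝ) ≤ s := by exact_mod_cast h1
  have h2' : (s : ℝ) ≤ n := by exact_mod_cast h2
  refine Set.Ico_subset_Ico (div_nonneg (by linarith) hn0.le) ?_
  rwa [div_le_one hn0]

lemma volume_stepSet {n : ℕ} {S : Finset ℤ} (hn : 1 ≤ n) :
    volume (stepSet n S) = ENNReal.ofReal (S.card / n) := by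
  have hn0 : (0 : ℝ) < n := by exact_mod_cast hn
  rw [stepSet, measure_biUnion_finset _ fun _ _ => measurableSet_Ico]
  · have : ∀ s : ℤ, volume (Set.Ico (((s : ℝ) - 1) / n) (s / n)) = ENNReal.ofReal (1 / n) := by
      intro s
      rw [Real.volume_Ico]
      congr 1
      ring
    simp only [this, Finset.sum_const, nsmul_eq_mul]
    rw [← ENNReal.ofReal_natCast, ← ENNReal.ofReal_mul (Nat.cast_nonneg _)]
    congr 1
    ring
  · intro s _ t _ hst
    rw [Function.onFun, Set.disjoint_left]
    rintro x ⟨h1, h2⟩ ⟨h3, h4⟩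
    rw [div_le_iff₀ hn0] at h1 h3
    rw [lt_div_iff₀ hn0] at h2 h4
    have h5 : (s : ℝ) < t + 1 := by linarith
    have h6 : (t : ℝ) < s + 1 := by linarith
    have h5' : s < t + 1 := by exact_mod_cast h5
    have h6' : t < s + 1 := by exact_mod_cast h6
    omega

lemma IsBStar.sum_tent_le {g : ℕ} {S : Finset ℤ} (hS : IsBStar g S) (z : ℝ) :
    ∑ p ∈ S ×ˢ S, max 0 (1 - |(p.1 : ℝ) + p.2 - z|) ≤ g := by
  set m := ⌊z⌋ with hm
  have hm1 : (m : ℝ) ≤ z := Int.floor_le z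
  have hm2 : z < m + 1 := Int.lt_floor_add_one z
  have hterm : ∀ p ∈ S ×ˢ S, max 0 (1 - |(p.1 : ℝ) + p.2 - z|) ≤
      (if p.1 + p.2 = m then 1 - (z - m) else 0) + if p.1 + p.2 = m + 1 then z - m else 0 := by
    intro p _
    have hcast : (p.1 : ℝ) + p.2 = ((p.1 + p.2 : ℤ) : ℝ) := by push_cast; ring
    rw [hcast]
    generalize p.1 + p.2 = k
    rcases lt_trichotomy k m with h | rfl | h
    · have h' : (k : ℝ) + 1 ≤ m := by exact_mod_cast h
      rw [if_neg (by omega), if_neg (by omega), abs_of_nonpos (by linarith)]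
      exact max_le (by simp) (by linarith)
    · rw [if_pos rfl, if_neg (by omega), abs_of_nonpos (by linarith)]
      exact max_le (by linarith) (by linarith)
    · rcases eq_or_ne k (m + 1) with rfl | h2
      · rw [if_neg (by omega), if_pos rfl]
        push_cast
        rw [abs_of_nonneg (by linarith)]
        exact max_le (by linarith) (by linarith)
      · have h' : (m : ℝ) + 2 ≤ k := by
          have : m + 2 ≤ k := by omega
          exact_mod_cast this
        rw [if_neg (by omega), if_neg (by omega), abs_of_nonneg (by linarith)]
        exact max_le (by simp) (by linarith)
  refine (Finset.sum_le_sum hterm).trans ?_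
  rw [Finset.sum_add_distrib, ← Finset.sum_filter, ← Finset.sum_filter, Finset.sum_const,
    Finset.sum_const, nsmul_eq_mul, nsmul_eq_mul]
  have h1 : (((S ×ˢ S).filter (fun p => p.1 + p.2 = m)).card : ℝ) ≤ g := by
    exact_mod_cast hS m
  have h2 : (((S ×ˢ S).filter (fun p => p.1 + p.2 = m + 1)).card : ℝ) ≤ g := by
    exact_mod_cast hS (m + 1)
  nlinarith

lemma IsBStar.DD_stepSet_le {g n : ℕ} {S : Finset ℤ} (hn : 1 ≤ n) (hS : IsBStar g S) :
    DD (stepSet n S) ≤ g / n := by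
  have hn0 : (0 : ℝ) < n := by exact_mod_cast hn
  refine Real.sSup_le ?_ (by positivity)
  rintro _ ⟨C, hCA, -, ⟨c, hc⟩, rfl⟩
  refine ENNReal.toReal_le_of_le_ofReal (by positivity) ?_
  have hcover : C ⊆ ⋃ p ∈ S ×ˢ S, Set.Icc (max (((p.1 : ℝ) - 1) / n) (2 * c - p.2 / n))
      (min (p.1 / n) (2 * c - ((p.2 : ℝ) - 1) / n)) := by
    intro x hx
    have hx' : 2 * c - x ∈ C := by
      have := (hc (x - c)).1 (by simpa using hx)
      rwa [show c - (x - c) = 2 * c - x by ring] at this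
    have h1 := hCA hx
    have h2 := hCA hx'
    simp only [stepSet, Set.mem_iUnion, exists_prop] at h1 h2
    obtain ⟨s, hs, hs1, hs2⟩ := h1
    obtain ⟨t, ht, ht1, ht2⟩ := h2
    simp only [Set.mem_iUnion, exists_prop]
    exact ⟨(s, t), Finset.mk_mem_product hs ht,
      max_le hs1 (by dsimp only; linarith), le_min hs2.le (by dsimp only; linarith)⟩
  refine (measure_mono hcover).trans ((measure_biUnion_finset_le _ _).trans ?_)
  have hlen : ∀ p ∈ S ×ˢ S, volume (Set.Icc (max (((p.1 : ℝ) - 1) / n) (2 * c - p.2 / n))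
      (min (p.1 / n) (2 * c - ((p.2 : ℝ) - 1) / n))) ≤
      ENNReal.ofReal (max 0 (1 - |(p.1 : ℝ) + p.2 - (2 * c * n + 1)|) / n) := by
    intro p _
    rw [Real.volume_Icc]
    refine ENNReal.ofReal_le_ofReal ?_
    refine le_trans ?_ (div_le_div_of_nonneg_right (le_max_right _ _) hn0.le)
    rw [le_div_iff₀ hn0]
    have e1 : (p.1 : ℝ) / n * n = p.1 := div_mul_cancel₀ _ hn0.ne'
    have e2 : (p.2 : ℝ) / n * n = p.2 := div_mul_cancel₀ _ hn0.ne'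
    have e3 : ((p.1 : ℝ) - 1) / n * n = p.1 - 1 := div_mul_cancel₀ _ hn0.ne'
    have e4 : ((p.2 : ℝ) - 1) / n * n = p.2 - 1 := div_mul_cancel₀ _ hn0.ne'
    rw [le_sub_comm]
    refine abs_le'.2 ⟨?_, ?_⟩
    · have i1 := le_max_left (((p.1 : ℝ) - 1) / n) (2 * c - p.2 / n)
      have i2 := min_le_right ((p.1 : ℝ) / n) (2 * c - ((p.2 : ℝ) - 1) / n)
      nlinarith [mul_le_mul_of_nonneg_right i1 hn0.le, mul_le_mul_of_nonneg_right i2 hn0.le]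
    · have i1 := le_max_right (((p.1 : ℝ) - 1) / n) (2 * c - p.2 / n)
      have i2 := min_le_left ((p.1 : ℝ) / n) (2 * c - ((p.2 : ℝ) - 1) / n)
      nlinarith [mul_le_mul_of_nonneg_right i1 hn0.le, mul_le_mul_of_nonneg_right i2 hn0.le]
  refine (Finset.sum_le_sum hlen).trans ?_
  rw [← ENNReal.ofReal_sum_of_nonneg fun p _ => div_nonneg (le_max_left _ _) hn0.le,
    ← Finset.sum_div]
  exact ENNReal.ofReal_le_ofReal
    (div_le_div_of_nonneg_right (hS.sum_tent_le (2 * c * n + 1)) hn0.le)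

lemma card_pairs_eq_of_Icc (n : ℕ) :
    (((Finset.Icc 1 (n : ℤ)) ×ˢ (Finset.Icc 1 (n : ℤ))).filter
      (fun p => p.1 + p.2 = (n : ℤ) + 1)).card = n := by
  have : ((Finset.Icc 1 (n : ℤ)) ×ˢ (Finset.Icc 1 (n : ℤ))).filter
      (fun p => p.1 + p.2 = (n : ℤ) + 1) =
      (Finset.Icc 1 (n : ℤ)).image fun s => (s, (n : ℤ) + 1 - s) := by
    ext ⟨a, b⟩
    simp only [Finset.mem_filter, Finset.mem_product, Finset.mem_Icc, Finset.mem_image,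
      Prod.mk.injEq]
    constructor
    · rintro ⟨⟨⟨_, _⟩, _, _⟩, _⟩
      exact ⟨a, by omega, rfl, by omega⟩
    · rintro ⟨s, _, rfl, rfl⟩
      omega
  rw [this, Finset.card_image_of_injective _ fun a b h => (Prod.mk.inj h).1]
  simp

lemma mul_card_sq_le_of_le_Delta {δ : ℝ} (hδ : 0 < δ)
    (h : ∀ ε : ℝ, 0 < ε → ε < 1 → δ ≤ Δ ε / ε ^ 2) {g n : ℕ} (hg : 1 ≤ g) (hgn : g ≤ n)
    {S : Finset ℤ} (hSn : S ⊆ Finset.Icc 1 (n : ℤ)) (hS : IsBStar g S) :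
    δ * (S.card : ℝ) ^ 2 ≤ g * n := by
  have hn : 1 ≤ n := hg.trans hgn
  have hn0 : (0 : ℝ) < n := by exact_mod_cast hn
  have hcard : S.card ≤ n := by simpa using Finset.card_le_card hSn
  rcases hcard.lt_or_eq with hlt | heq
  · rcases S.card.eq_zero_or_pos with h0 | hpos
    · rw [h0]
      simp only [Nat.cast_zero, ne_eq, OfNat.ofNat_ne_zero, not_false_eq_true, zero_pow, mul_zero]
      positivity
    · have hpos' : (0 : ℝ) < S.card := by exact_mod_cast hpos
      have hlt' : (S.card : ℝ) < n := by exact_mod_cast hlt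
      have h1 := h (S.card / n) (by positivity) ((div_lt_one hn0).2 hlt')
      rw [le_div_iff₀ (by positivity)] at h1
      have h2 := h1.trans ((Delta_le_DD (stepSet_subset hn hSn) (measurableSet_stepSet n S)
        (volume_stepSet hn)).trans (hS.DD_stepSet_le hn))
      rw [le_div_iff₀ hn0] at h2
      calc δ * (S.card : ℝ) ^ (2 : ℕ) = δ * ((S.card : ℝ) / n) ^ 2 * n * n := by field_simp
        _ ≤ g * n := mul_le_mul_of_nonneg_right h2 hn0.le
  · have hSeq : S = Finset.Icc 1 (n : ℤ) :=
      Finset.eq_of_subset_of_card_le hSn (by simp [heq])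
    have hng : n ≤ g := by
      have := hS ((n : ℤ) + 1)
      rwa [hSeq, card_pairs_eq_of_Icc] at this
    have hng' : (n : ℝ) ≤ g := by exact_mod_cast hng
    rw [heq]
    nlinarith [le_one_of_le_Delta hδ h, mul_le_mul_of_nonneg_right hng' hn0.le, sq_nonneg (n : ℝ)]

/-! ### The lower bound `0.591389` via a tent kernel -/

/-- The tent function of half-width `w` on the integers. -/
def tent (w : ℕ) (k : ℤ) : ℝ := ((w - k.natAbs : ℕ) : ℝ)

lemma tent_nonneg (w : ℕ) (k : ℤ) : 0 ≤ tent w k := Nat.cast_nonneg _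

lemma tent_neg (w : ℕ) (k : ℤ) : tent w (-k) = tent w k := by simp [tent]

lemma sum_Ico_neg_natAbs (f : ℕ → ℝ) (N : ℕ) :
    ∑ k ∈ Finset.Ico (-(N : ℤ)) N, f k.natAbs =
      ∑ k ∈ Finset.range N, f k + ∑ k ∈ Finset.range (N + 1), f k - f 0 := by
  induction N with
  | zero => simp
  | succ N ih =>
    have : Finset.Ico (-((N + 1 : ℕ) : ℤ)) ((N + 1 : ℕ) : ℤ) =
        insert (-((N : ℤ) + 1)) (insert (N : ℤ) (Finset.Ico (-(N : ℤ)) N)) := by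
      ext k
      simp only [Finset.mem_Ico, Finset.mem_insert]
      omega
    rw [this, Finset.sum_insert (by simp only [Finset.mem_insert, Finset.mem_Ico]; omega),
      Finset.sum_insert (by simp), ih, Finset.sum_range_succ f (N + 1), Finset.sum_range_succ f N]
    rw [show (-((N : ℤ) + 1)).natAbs = N + 1 by omega, Int.natAbs_natCast]
    ring

lemma sum_range_tsub {w N : ℕ} (h : w ≤ N) :
    ∑ k ∈ Finset.range N, ((w - k : ℕ) : ℝ) = w * (w + 1) / 2 := by
  induction w generalizing N with
  | zero => simp
  | succ w ih =>
    obtain ⟨M, rfl⟩ : ∃ M, N = M + 1 := ⟨N - 1, by omega⟩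
    simp only [Finset.sum_range_succ', Nat.add_sub_add_right, ih (Nat.le_of_succ_le_succ h)]
    push_cast
    ring

lemma sum_range_tsub_sq {w N : ℕ} (h : w ≤ N) :
    ∑ k ∈ Finset.range N, ((w - k : ℕ) : ℝ) ^ 2 = w * (w + 1) * (2 * w + 1) / 6 := by
  induction w generalizing N with
  | zero => simp
  | succ w ih =>
    obtain ⟨M, rfl⟩ : ∃ M, N = M + 1 := ⟨N - 1, by omega⟩
    simp only [Finset.sum_range_succ', Nat.add_sub_add_right, ih (Nat.le_of_succ_le_succ h)]
    push_cast
    ring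

lemma sum_tent {w N : ℕ} (h : w ≤ N) :
    ∑ k ∈ Finset.Ico (-(N : ℤ)) N, tent w k = (w : ℝ) ^ 2 := by
  simp only [tent]
  rw [sum_Ico_neg_natAbs (fun k => ((w - k : ℕ) : ℝ)), sum_range_tsub h,
    sum_range_tsub (h.trans N.le_succ), Nat.sub_zero]
  ring

lemma sum_tent_sq {w N : ℕ} (h : w ≤ N) :
    ∑ k ∈ Finset.Ico (-(N : ℤ)) N, tent w k ^ 2 = (w : ℝ) * (2 * w ^ 2 + 1) / 3 := by
  simp only [tent]
  rw [sum_Ico_neg_natAbs (fun k => ((w - k : ℕ) : ℝ) ^ 2), sum_range_tsub_sq h,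
    sum_range_tsub_sq (h.trans N.le_succ), Nat.sub_zero]
  ring

/-- Lower bound for the energy of a finite family of points of `{1, …, n}` with respect to the
tent kernel, by counting points in windows of length `w`. -/
lemma sq_card_mul_le_sum_tent {ι : Type*} (I : Finset ι) (u : ι → ℤ) (n w : ℕ)
    (hu : ∀ i ∈ I, u i ∈ Finset.Icc 1 (n : ℤ)) :
    ((I.card : ℝ) * w) ^ 2 ≤ (n + w) * ∑ i ∈ I, ∑ j ∈ I, tent w (u i - u j) := by
  set X := Finset.Icc 1 ((n + w : ℕ) : ℤ) with hX
  set ind : ι → ℤ → ℝ := fun i x => if x ∈ Finset.Ico (u i) (u i + w) then 1 else 0 with hind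
  have hsub : ∀ i ∈ I, Finset.Ico (u i) (u i + w) ⊆ X := by
    intro i hi x hx
    have := Finset.mem_Icc.1 (hu i hi)
    simp only [hX, Finset.mem_Ico, Finset.mem_Icc] at hx ⊢
    omega
  have h1 : ∑ x ∈ X, ∑ i ∈ I, ind i x = I.card * w := by
    rw [Finset.sum_comm, Finset.cast_card, Finset.sum_mul]
    refine Finset.sum_congr rfl fun i hi => ?_
    rw [Finset.sum_ite_mem, Finset.inter_eq_right.2 (hsub i hi)]
    simp
  have h2 : ∑ x ∈ X, (∑ i ∈ I, ind i x) ^ 2 = ∑ i ∈ I, ∑ j ∈ I, tent w (u i - u j) := by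
    simp_rw [sq, Finset.sum_mul_sum]
    rw [Finset.sum_comm]
    refine Finset.sum_congr rfl fun i hi => ?_
    rw [Finset.sum_comm]
    refine Finset.sum_congr rfl fun j _ => ?_
    have : ∀ x, ind i x * ind j x =
        if x ∈ Finset.Ico (max (u i) (u j)) (min (u i + w) (u j + w)) then 1 else 0 := by
      intro x
      simp only [hind, ← ite_and, mul_ite, mul_one, mul_zero, Finset.mem_Ico]
      congr 1
      simp only [max_le_iff, lt_min_iff, eq_iff_iff]
      tauto
    simp only [this]
    rw [Finset.sum_ite_mem, Finset.inter_eq_right.2]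
    · simp only [Finset.sum_const, Int.card_Ico, nsmul_eq_mul, mul_one, tent]
      congr 1
      omega
    · refine subset_trans ?_ (hsub i hi)
      exact Finset.Ico_subset_Ico (le_max_left _ _) (min_le_left _ _)
  have hcs := sq_sum_le_card_mul_sum_sq (s := X) (f := fun x => ∑ i ∈ I, ind i x)
  rw [h1, h2] at hcs
  have hXcard : (X.card : ℝ) = n + w := by
    rw [hX, Int.card_Icc, add_sub_cancel_right, Int.toNat_natCast, Nat.cast_add]
  rwa [hXcard] at hcs

/-- The number of representations of `k` as a difference of two elements of `S`. -/
def diffCount (S : Finset ℤ) (k : ℤ) : ℕ := ((S ×ˢ S).filter (fun p => p.1 - p.2 = k)).card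

lemma sum_card_fiber_mul {α β : Type*} [DecidableEq β] {P : Finset α} {J : Finset β} {φ : α → β}
    (h : ∀ p ∈ P, φ p ∈ J) (F : β → ℝ) :
    ∑ k ∈ J, ((P.filter (fun p => φ p = k)).card : ℝ) * F k = ∑ p ∈ P, F (φ p) := by
  rw [← Finset.sum_fiberwise_of_maps_to' h]
  simp

lemma IsBStar.sum_diffCount_le {g : ℕ} {S : Finset ℤ} (hS : IsBStar g S) :
    ∑ p ∈ S ×ˢ S, diffCount S (p.1 - p.2) ≤ g * S.card ^ 2 := by
  have hsum : ∑ p ∈ S ×ˢ S, diffCount S (p.1 - p.2) =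
      ∑ p ∈ S ×ˢ S, ((S ×ˢ S).filter (fun q => q.1 + q.2 = p.1 + p.2)).card := by
    simp only [diffCount, Finset.card_filter, Finset.sum_product]
    refine Finset.sum_congr rfl fun a _ => ?_
    rw [Finset.sum_comm_cycle]
    refine Finset.sum_congr rfl fun e _ => ?_
    rw [Finset.sum_comm]
    refine Finset.sum_congr rfl fun c _ => Finset.sum_congr rfl fun b _ => ?_
    exact if_congr (by omega) rfl rfl
  rw [hsum]
  refine (Finset.sum_le_card_nsmul _ _ g fun p _ => hS _).trans_eq ?_
  rw [Finset.card_product, smul_eq_mul]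
  ring

lemma IsBStar.card_sq_le_of_eq_four_mul {g n w : ℕ} {S : Finset ℤ} (hw : 2 ≤ w) (hnw : n = 4 * w)
    (hSn : S ⊆ Finset.Icc 1 (n : ℤ)) (hS : IsBStar g S) :
    (0.591389 : ℝ) * (S.card : ℝ) ^ 2 ≤ g * n := by
  have hmem : ∀ s ∈ S, 1 ≤ s ∧ s ≤ n := fun s hs => Finset.mem_Icc.1 (hSn hs)
  set J := Finset.Ico (-(n : ℤ)) n with hJ
  have hJcard : (J.card : ℝ) = 8 * w := by
    rw [hJ, Int.card_Ico, show ((n : ℤ) - -(n : ℤ)).toNat = 8 * w by omega]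
    push_cast
    rfl
  have hwn : w ≤ n := by omega
  have hmaps : ∀ p ∈ S ×ˢ S, p.1 - p.2 ∈ J := by
    intro p hp
    obtain ⟨h1, h2⟩ := Finset.mem_product.1 hp
    have := hmem _ h1
    have := hmem _ h2
    rw [hJ, Finset.mem_Ico]
    omega
  have hmaps' : ∀ p ∈ S ×ˢ S, p.1 + p.2 - ((n : ℤ) + 1) ∈ J := by
    intro p hp
    obtain ⟨h1, h2⟩ := Finset.mem_product.1 hp
    have := hmem _ h1
    have := hmem _ h2
    rw [hJ, Finset.mem_Ico]
    omega
  set a : ℝ := (S.card : ℝ) ^ 2 with ha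
  set D : ℝ := ∑ p ∈ S ×ˢ S, tent w (p.1 - p.2) with hD
  set E : ℝ := ∑ p ∈ S ×ˢ S, tent w (p.1 + p.2 - ((n : ℤ) + 1)) with hE
  have hEle : E ≤ g * (w : ℝ) ^ 2 := by
    rw [hE, ← sum_card_fiber_mul hmaps' (tent w), ← sum_tent hwn, Finset.mul_sum]
    refine Finset.sum_le_sum fun k _ => mul_le_mul_of_nonneg_right ?_ (tent_nonneg w k)
    have := hS (k + ((n : ℤ) + 1))
    simp only [← sub_eq_iff_eq_add] at this
    exact_mod_cast this
  have hDE : 4 * a * w ^ 2 ≤ 5 * w * (2 * D + 2 * E) := by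
    have key := sq_card_mul_le_sum_tent (S.disjSum S)
      (Sum.elim (fun s => s) (fun s => (n : ℤ) + 1 - s)) n w (by
        intro i hi
        rw [Finset.mem_Icc]
        rcases Finset.mem_disjSum.1 hi with ⟨s, hs, rfl⟩ | ⟨s, hs, rfl⟩
        all_goals
          have := hmem s hs
          simp only [Sum.elim_inl, Sum.elim_inr]
          omega)
    have e1 : ∀ s t : ℤ, tent w (s - ((n : ℤ) + 1 - t)) = tent w (s + t - ((n : ℤ) + 1)) :=
      fun s t => congrArg _ (by ring)
    have e2 : ∀ s t : ℤ, tent w ((n : ℤ) + 1 - s - t) = tent w (s + t - ((n : ℤ) + 1)) :=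
      fun s t => by rw [← tent_neg]; exact congrArg _ (by ring)
    have e3 : ∀ s t : ℤ, tent w ((n : ℤ) + 1 - s + t - ((n : ℤ) + 1)) = tent w (s - t) :=
      fun s t => by rw [← tent_neg]; exact congrArg _ (by ring)
    simp only [Finset.sum_disjSum, Sum.elim_inl, Sum.elim_inr, Finset.sum_add_distrib, e1, e2, e3,
      Finset.card_disjSum] at key
    simp only [← Finset.sum_product'] at key
    rw [← hD, ← hE, hnw] at key
    push_cast at key
    rw [ha]
    linarith
  have hsumd : ∑ k ∈ J, (diffCount S k : ℝ) = a := by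
    have := sum_card_fiber_mul hmaps fun _ => (1 : ℝ)
    simpa [sq, ha, diffCount] using this
  have hsumdT : ∑ k ∈ J, (diffCount S k : ℝ) * tent w k = D := sum_card_fiber_mul hmaps (tent w)
  have hsumdd : ∑ k ∈ J, (diffCount S k : ℝ) ^ 2 ≤ g * a := by
    simp_rw [sq]
    refine (sum_card_fiber_mul hmaps fun k => (diffCount S k : ℝ)).trans_le ?_
    rw [ha]
    exact_mod_cast hS.sum_diffCount_le
  have hsumT : ∑ k ∈ J, tent w k = (w : ℝ) ^ 2 := sum_tent hwn
  have hsumTT : ∑ k ∈ J, tent w k ^ 2 = (w : ℝ) * (2 * w ^ 2 + 1) / 3 := sum_tent_sq hwn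
  have hw' : (2 : ℝ) ≤ w := by exact_mod_cast hw
  have hw0 : (0 : ℝ) < w := by linarith
  set α : ℝ := a / (8 * w) with hα
  have hαw : α * (8 * w) = a := div_mul_cancel₀ _ (by positivity)
  have hcs := Finset.sum_mul_sq_le_sq_mul_sq J (fun k => (diffCount S k : ℝ) - α)
    (fun k => tent w k - w / 8)
  have c1 : ∑ k ∈ J, ((diffCount S k : ℝ) - α) * (tent w k - w / 8) = D - a * w / 8 := by
    have : ∀ k, ((diffCount S k : ℝ) - α) * (tent w k - w / 8) = diffCount S k * tent w k -
        w / 8 * diffCount S k - α * tent w k + α * (w / 8) := fun k => by ring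
    simp only [this, Finset.sum_add_distrib, Finset.sum_sub_distrib, ← Finset.mul_sum, hsumd,
      hsumdT, hsumT, Finset.sum_const, nsmul_eq_mul, hJcard]
    ring
  have c2 : ∑ k ∈ J, ((diffCount S k : ℝ) - α) ^ 2 ≤ g * a - α * a := by
    have : ∀ k, ((diffCount S k : ℝ) - α) ^ 2 = (diffCount S k : ℝ) ^ 2 -
        2 * α * diffCount S k + α ^ 2 := fun k => by ring
    simp only [this, Finset.sum_add_distrib, Finset.sum_sub_distrib, ← Finset.mul_sum, hsumd,
      Finset.sum_const, nsmul_eq_mul, hJcard]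
    linear_combination hsumdd + α * hαw
  have c3 : ∑ k ∈ J, (tent w k - w / 8) ^ 2 ≤ 5 / 8 * (w : ℝ) ^ 3 := by
    have : ∀ k, (tent w k - w / 8) ^ 2 = tent w k ^ 2 -
        w / 4 * tent w k + (w / 8 : ℝ) ^ 2 := fun k => by ring
    simp only [this, Finset.sum_add_distrib, Finset.sum_sub_distrib, ← Finset.mul_sum, hsumT,
      hsumTT, Finset.sum_const, nsmul_eq_mul, hJcard]
    nlinarith [mul_nonneg hw0.le (mul_nonneg (sub_nonneg.2 hw') (by linarith : (0 : ℝ) ≤ w + 2))]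
  rw [c1] at hcs
  have hcs' : (D - a * w / 8) ^ 2 ≤ (g * a - α * a) * (5 / 8 * (w : ℝ) ^ 3) :=
    hcs.trans (mul_le_mul c2 c3 (Finset.sum_nonneg fun _ _ => sq_nonneg _)
      ((Finset.sum_nonneg fun _ _ => sq_nonneg _).trans c2))
  have hrhs : (g * a - α * a) * (5 / 8 * (w : ℝ) ^ 3) =
      w ^ 2 * (5 / 8 * (g * w * a - a ^ 2 / 8)) := by
    linear_combination (-(5 / 64) * a * (w : ℝ) ^ 2) * hαw
  rw [hrhs] at hcs'
  by_contra! hlt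
  rw [hnw] at hlt
  push_cast at hlt
  set G : ℝ := g * w with hG
  have hG0 : 0 ≤ G := by positivity
  have hDlow : w * (0.275 * a - G) ≤ D - a * w / 8 := by
    have h5 : w * (4 * a * w) ≤ w * (5 * (2 * D + 2 * E)) := by linarith
    have h6 := le_of_mul_le_mul_left h5 hw0
    have h7 : (g : ℝ) * w ^ 2 = w * G := by rw [hG]; ring
    linarith
  have ha0 : 0 < a := by nlinarith
  have hGa : G < 0.14784725 * a := by linarith
  have h8 : (w * (0.275 * a - G)) ^ 2 ≤ w ^ 2 * (5 / 8 * (G * a - a ^ 2 / 8)) :=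
    (pow_le_pow_left₀ (mul_nonneg hw0.le (by linarith)) hDlow 2).trans hcs'
  rw [mul_pow] at h8
  have h9 := le_of_mul_le_mul_left h8 (by positivity)
  nlinarith [mul_pos (sub_pos.2 hGa) ha0, mul_pos (sub_pos.2 hGa) (sub_pos.2 hGa), mul_pos ha0 ha0]

/-- Replace every element of `S` by a block of eight consecutive integers. -/
noncomputable def blockExpansion (n : ℕ) (S : Finset ℤ) : Finset ℤ :=
  (Finset.Icc 1 ((8 * n : ℕ) : ℤ)).filter fun x => (x - 1) / 8 + 1 ∈ S

lemma card_blockExpansion {n : ℕ} {S : Finset ℤ} (hSn : S ⊆ Finset.Icc 1 (n : ℤ)) :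
    (blockExpansion n S).card = 8 * S.card := by
  refine (Finset.card_eq_sum_card_fiberwise (s := blockExpansion n S)
    (f := fun x : ℤ => (x - 1) / 8 + 1) (t := S) fun x hx => (Finset.mem_filter.1 hx).2).trans ?_
  have : ∀ s ∈ S, ((blockExpansion n S).filter fun x => (x - 1) / 8 + 1 = s).card = 8 := by
    intro s hs
    have hs' := Finset.mem_Icc.1 (hSn hs)
    have : (blockExpansion n S).filter (fun x => (x - 1) / 8 + 1 = s) =
        Finset.Icc (8 * s - 7) (8 * s) := by
      ext x
      simp only [blockExpansion, Finset.mem_filter, Finset.mem_Icc]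
      constructor
      · rintro ⟨-, rfl⟩
        omega
      · rintro ⟨h1, h2⟩
        have h3 : (x - 1) / 8 + 1 = s := by omega
        exact ⟨⟨by omega, h3 ▸ hs⟩, h3⟩
    rw [this, Int.card_Icc]
    omega
  rw [Finset.sum_congr rfl this, Finset.sum_const, smul_eq_mul, mul_comm]

lemma IsBStar.isBStar_blockExpansion {g n : ℕ} {S : Finset ℤ} (hS : IsBStar g S) :
    IsBStar (8 * g) (blockExpansion n S) := by
  intro m
  refine (Finset.card_le_mul_card_image_of_maps_to (f := fun p : ℤ × ℤ => (p.1 - 1) % 8)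
    (t := Finset.Ico 0 8) (fun p _ => ?_) g fun i _ => ?_).trans_eq (by simp [mul_comm])
  · rw [Finset.mem_Ico]
    omega
  · refine le_trans (Finset.card_le_card_of_injOn
      (fun p : ℤ × ℤ => ((p.1 - 1) / 8 + 1, (p.2 - 1) / 8 + 1)) ?_ ?_)
      (hS ((m - 2 - i) / 8 + 2))
    · rintro ⟨x, y⟩ hp
      simp only [blockExpansion, Finset.coe_filter, Finset.mem_filter, Finset.mem_product,
        Set.mem_ofPred_eq] at hp ⊢
      exact ⟨⟨hp.1.1.1.2, hp.1.1.2.2⟩, by omega⟩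
    · rintro ⟨x, y⟩ hp ⟨x', y'⟩ hp' h
      simp only [Finset.coe_filter, Finset.mem_filter, Set.mem_ofPred_eq, Prod.mk.injEq]
        at hp hp' h ⊢
      omega

lemma IsBStar.card_sq_le {g n : ℕ} {S : Finset ℤ} (hn : 1 ≤ n)
    (hSn : S ⊆ Finset.Icc 1 (n : ℤ)) (hS : IsBStar g S) :
    (0.591389 : ℝ) * (S.card : ℝ) ^ 2 ≤ g * n := by
  have := hS.isBStar_blockExpansion.card_sq_le_of_eq_four_mul (n := 8 * n) (w := 2 * n)
    (by omega) (by ring)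
    (Finset.filter_subset _ _)
  rw [← blockExpansion, card_blockExpansion hSn] at this
  push_cast at this
  linarith

theorem delta_R_basic :
    (∀ δ : ℝ, 0 < δ → (∀ ε : ℝ, 0 < ε → ε < 1 → δ ≤ Δ ε / ε^2) →
      ∀ g n : ℕ, 1 ≤ g → g ≤ n → (R g n : ℝ) ≤ δ ^ (-(1/2) : ℝ) * Real.sqrt (g * n)) ∧
    (∀ g n : ℕ, 1 ≤ g → g ≤ n →
      (R g n : ℝ) ≤ (0.591389 : ℝ) ^ (-(1/2) : ℝ) * Real.sqrt (g * n) ∧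
      (R g n : ℝ) < 1.30036 * Real.sqrt (g * n)) := by
  refine ⟨fun δ hδ h g n hg hgn => ?_, fun g n hg hgn => ?_⟩
  · obtain ⟨S, hSn, hS, hcard⟩ := exists_card_eq_R g n
    rw [← hcard]
    exact le_rpow_neg_half_mul_sqrt hδ
      (mul_card_sq_le_of_le_Delta hδ h hg hgn hSn hS)
  · obtain ⟨S, hSn, hS, hcard⟩ := exists_card_eq_R g n
    rw [← hcard]
    have key := IsBStar.card_sq_le (hg.trans hgn) hSn hS
    refine ⟨le_rpow_neg_half_mul_sqrt (by norm_num) key, ?_⟩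
    have hpos : (0 : ℝ) < g * n := by
      have : 0 < g * n := Nat.mul_pos hg (hg.trans hgn)
      exact_mod_cast this
    rw [← Real.sqrt_sq (Nat.cast_nonneg S.card : (0 : ℝ) ≤ S.card),
      show (1.30036 : ℝ) = √(1.30036 ^ 2) by rw [Real.sqrt_sq (by norm_num)],
      ← Real.sqrt_mul (by norm_num)]
    exact Real.sqrt_lt_sqrt (by positivity) (by nlinarith)
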